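/- Let d ≥ 2 and r > d, and let m^0 ∈ C_r(ℝ^d) be given by m^0(s) = b(s)²/γ_s. There exist ε_* > 0, δ > 0 and C > 0 such that for every ε ∈ [0, ε_*] there is exactly one y ∈ C_r(ℝ^d) with ‖y − m^0‖_r ≤ δ satisfying the steady-state equation −2γ_s y(s) + 2b(s)² + ε K_s(y) = 0 for all s ∈ ℝ^d; moreover this steady state m^ε satisfies ‖m^ε − m^0‖_r ≤ C ε. -/

import Mathlib

open MeasureTheory

noncomputable section

/-- `ℝ^d` with its Euclidean structure. -/
abbrev Rd (d : ℕ) := EuclideanSpace ℝ (Fin d)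

/-- Integral of `f` over the hyperplane `x^⊥ = {z : x·z = 0}` with respect to the
`(d-1)`-dimensional Lebesgue measure induced by the Euclidean inner product. -/
noncomputable def hyperplaneIntegral (d : ℕ) (x : Rd d) (f : Rd d → ℝ) : ℝ :=
  ∫ z : ((ℝ ∙ x)ᗮ : Submodule ℝ (Rd d)), f (z : Rd d)

/-- The weighted sup-norm `‖y‖_r = sup_s (1+|s|)^r |y(s)|`. -/
noncomputable def wNorm (d : ℕ) (r : ℝ) (y : Rd d → ℝ) : ℝ :=
  ⨆ s : Rd d, (1 + ‖s‖) ^ r * |y s|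

/-- Membership in the space `C_r(ℝ^d)` of continuous functions with finite `‖·‖_r`. -/
def memCr (d : ℕ) (r : ℝ) (y : Rd d → ℝ) : Prop :=
  Continuous y ∧ ∃ K : ℝ, ∀ s : Rd d, (1 + ‖s‖) ^ r * |y s| ≤ K

/-- The integrand of the wave kinetic integral. -/
noncomputable def kinIntegrand (d : ℕ) (y : Rd d → ℝ) (s x z : Rd d) : ℝ :=
  y (s + x) * y (s + z) * y (s + x + z) + y (s + x) * y (s + z) * y s
    - y (s + z) * y (s + x + z) * y s - y (s + x) * y (s + x + z) * y s

/-- The wave kinetic integral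
`K_s(y) = 2π ∫_{ℝ^d} |x|⁻¹ (∫_{x^⊥} [...] dz) dx`. -/
noncomputable def Kwk (d : ℕ) (y : Rd d → ℝ) (s : Rd d) : ℝ :=
  2 * Real.pi * ∫ x : Rd d, ‖x‖⁻¹ * hyperplaneIntegral d x (kinIntegrand d y s x)

/-- `γ_s = (1+|s|²)^{r_*}`. -/
noncomputable def gam (d : ℕ) (rstar : ℝ) (s : Rd d) : ℝ := (1 + ‖s‖ ^ 2) ^ rstar

/-- A steady state of the damped/driven wave kinetic equation:
`−2γ_s y(s) + 2b(s)² + ε K_s(y) = 0` for all `s`, with `y ∈ C_r(ℝ^d)`. -/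
def IsSteadyState (d : ℕ) (r rstar : ℝ) (b : Rd d → ℝ) (ε : ℝ) (y : Rd d → ℝ) : Prop :=
  memCr d r y ∧
  ∀ s : Rd d, -2 * gam d rstar s * y s + 2 * (b s) ^ 2 + ε * Kwk d y s = 0

/-- The decaying weight `(1+|v|)^{-r}`. -/
def decayWeight {F : Type*} [NormedAddCommGroup F] (r : ℝ) (v : F) : ℝ := (1 + ‖v‖) ^ (-r)

section DecayWeight

variable {F : Type*} [NormedAddCommGroup F] {r : ℝ}

lemma decayWeight_pos (v : F) : 0 < decayWeight r v := by
  unfold decayWeight; positivity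

lemma decayWeight_le_one (hr : 0 < r) (v : F) : decayWeight r v ≤ 1 :=
  Real.rpow_le_one_of_one_le_of_nonpos (by linarith [norm_nonneg v]) (by linarith)

lemma continuous_decayWeight : Continuous (decayWeight r : F → ℝ) := by
  unfold decayWeight
  exact (by fun_prop : Continuous fun v : F => 1 + ‖v‖).rpow_const
    fun v => Or.inl (by positivity)

lemma rpow_mul_decayWeight (v : F) : (1 + ‖v‖) ^ r * decayWeight r v = 1 := by
  rw [decayWeight, ← Real.rpow_add (by positivity)]
  simp

lemma rpow_mul_le_iff (v : F) (a M : ℝ) :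
    (1 + ‖v‖) ^ r * a ≤ M ↔ a ≤ M * decayWeight r v := by
  rw [decayWeight, Real.rpow_neg (by positivity), ← div_eq_mul_inv,
    le_div_iff₀ (by positivity), mul_comm]

lemma decayWeight_anti {G : Type*} [NormedAddCommGroup G] (hr : 0 < r) {u : F} {v : G}
    (h : ‖u‖ ≤ ‖v‖) : decayWeight r v ≤ decayWeight r u :=
  Real.rpow_le_rpow_of_nonpos (by positivity) (by linarith) (by linarith)

lemma decayWeight_le_two_rpow_mul (hr : 0 < r) {u v : F} (h : 1 + ‖u‖ ≤ 2 * (1 + ‖v‖)) :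
    decayWeight r v ≤ 2 ^ r * decayWeight r u := by
  have h1 : (2 : ℝ) ^ r * decayWeight r u = ((1 + ‖u‖) / 2) ^ (-r) := by
    rw [decayWeight, Real.div_rpow (by positivity) (by norm_num), Real.rpow_neg zero_le_two]
    field_simp
  rw [h1]
  exact Real.rpow_le_rpow_of_nonpos (by positivity) (by linarith) (by linarith)

end DecayWeight

section Rectangle

variable {F : Type*} [NormedAddCommGroup F] {r : ℝ}

/-- A product majorant for the weights at the vertices of the rectangle spanned at `s` by the
orthogonal sides `x` and `z`. -/
def rectWeight (r : ℝ) (s x z : F) : ℝ :=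
  (decayWeight r (s + x) + decayWeight r x) * (decayWeight r (s + z) + decayWeight r (s + x + z))

lemma norm_le_two_mul_of_inner_eq_zero [InnerProductSpace ℝ F] {s x z : F} (h : inner ℝ x z = 0) :
    ‖s‖ ≤ 2 * ‖s + x‖ ∨ ‖s‖ ≤ 2 * ‖s + z‖ := by
  by_contra! hc
  have h1 := norm_add_sq_real s x
  have h2 := norm_add_sq_real s z
  have h3 := norm_add_sq_real (s + x) z
  have h4 := norm_add_sq_real s x
  have h5 : inner ℝ (s + x) z = inner ℝ s z := by rw [inner_add_left, h, add_zero]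
  nlinarith [norm_nonneg s, norm_nonneg (s + x), norm_nonneg (s + z), sq_nonneg ‖s + x + z‖]

lemma sum_vertex_products_le [InnerProductSpace ℝ F] (hr : 0 < r) {s x z : F}
    (h : inner ℝ x z = 0) :
    decayWeight r (s + x) * decayWeight r (s + z) * decayWeight r (s + x + z)
      + decayWeight r (s + x) * decayWeight r (s + z) * decayWeight r s
      + decayWeight r (s + z) * decayWeight r (s + x + z) * decayWeight r s
      + decayWeight r (s + x) * decayWeight r (s + x + z) * decayWeight r s
      ≤ (1 + 2 ^ r) * 2 ^ r * decayWeight r s * rectWeight r s x z := by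
  have hA : (1 : ℝ) ≤ 2 ^ r := Real.one_le_rpow one_le_two hr.le
  have hopp : decayWeight r (s + z) * decayWeight r (s + x + z) ≤
      2 ^ r * decayWeight r x * (decayWeight r (s + z) + decayWeight r (s + x + z)) := by
    have hx : ‖x‖ ≤ ‖s + z‖ + ‖s + x + z‖ := by
      have := norm_sub_le (s + x + z) (s + z)
      rwa [show s + x + z - (s + z) = x by abel, add_comm] at this
    have p1 := decayWeight_pos (r := r) (s + z)
    have p2 := decayWeight_pos (r := r) (s + x + z)
    have p3 := decayWeight_pos (r := r) x
    rcases le_total ‖s + z‖ ‖s + x + z‖ with hle | hle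
    · have := decayWeight_le_two_rpow_mul hr (u := x) (v := s + x + z) (by linarith)
      nlinarith [mul_le_mul_of_nonneg_left this p1.le,
        mul_pos (mul_pos (zero_lt_one.trans_le hA) p3) p2]
    · have := decayWeight_le_two_rpow_mul hr (u := x) (v := s + z) (by linarith)
      nlinarith [mul_le_mul_of_nonneg_right this p2.le,
        mul_pos (mul_pos (zero_lt_one.trans_le hA) p3) p1]
  have htriple : decayWeight r (s + x) * decayWeight r (s + z) * decayWeight r (s + x + z) ≤
      2 ^ r * decayWeight r s * (decayWeight r (s + z) * decayWeight r (s + x + z)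
        + decayWeight r (s + x) * decayWeight r (s + x + z)) := by
    have p1 := decayWeight_pos (r := r) (s + z)
    have p2 := decayWeight_pos (r := r) (s + x + z)
    have p3 := decayWeight_pos (r := r) (s + x)
    have p4 : 0 < 2 ^ r * decayWeight r s :=
      mul_pos (zero_lt_one.trans_le hA) (decayWeight_pos s)
    rcases norm_le_two_mul_of_inner_eq_zero (s := s) h with hle | hle
    · have := decayWeight_le_two_rpow_mul hr (u := s) (v := s + x) (by linarith)
      nlinarith [mul_le_mul_of_nonneg_right this (mul_pos p1 p2).le, mul_pos p4 (mul_pos p3 p2)]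
    · have := decayWeight_le_two_rpow_mul hr (u := s) (v := s + z) (by linarith)
      nlinarith [mul_le_mul_of_nonneg_right this (mul_pos p3 p2).le, mul_pos p4 (mul_pos p1 p2)]
  have p0 := decayWeight_pos (r := r) s
  have p1 := decayWeight_pos (r := r) (s + z)
  have p2 := decayWeight_pos (r := r) (s + x + z)
  have p3 := decayWeight_pos (r := r) (s + x)
  have p4 := decayWeight_pos (r := r) x
  unfold rectWeight
  generalize decayWeight r s = a at *
  generalize decayWeight r (s + x) = b at *
  generalize decayWeight r (s + z) = c at *
  generalize decayWeight r (s + x + z) = e at *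
  generalize decayWeight r x = f at *
  generalize (2 : ℝ) ^ r = A at *
  calc b * c * e + b * c * a + c * e * a + b * e * a
      ≤ A * a * (c * e + b * e) + b * c * a + c * e * a + b * e * a := by linarith
    _ ≤ (1 + A) * a * (c * e + b * (c + e)) := by
        nlinarith [mul_pos p0 (mul_pos p3 p1)]
    _ ≤ (1 + A) * a * (A * f * (c + e) + A * (b * (c + e))) := by
        have : b * (c + e) ≤ A * (b * (c + e)) := le_mul_of_one_le_left (by positivity) hA
        gcongr
    _ = (1 + A) * A * a * ((b + f) * (c + e)) := by ring

lemma rectWeight_nonneg (s x z : F) : 0 ≤ rectWeight r s x z :=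
  (mul_pos (add_pos (decayWeight_pos _) (decayWeight_pos _))
    (add_pos (decayWeight_pos _) (decayWeight_pos _))).le

lemma decayWeight_add_le_of_norm_sub_le_one (hr : 0 < r) {s s₀ : F} (hs : ‖s - s₀‖ ≤ 1) (p : F) :
    decayWeight r (s + p) ≤ 2 ^ r * decayWeight r (s₀ + p) := by
  refine decayWeight_le_two_rpow_mul hr ?_
  have := norm_sub_le (s + p) (s - s₀)
  rw [show s + p - (s - s₀) = s₀ + p by abel] at this
  linarith [norm_nonneg (s + p)]

lemma rectWeight_le_of_norm_sub_le_one (hr : 0 < r) {s s₀ : F} (hs : ‖s - s₀‖ ≤ 1) (x z : F) :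
    rectWeight r s x z ≤ 2 ^ r * 2 ^ r * rectWeight r s₀ x z := by
  have hA : (1 : ℝ) ≤ 2 ^ r := Real.one_le_rpow one_le_two hr.le
  have h1 := decayWeight_add_le_of_norm_sub_le_one hr hs x
  have h2 := decayWeight_add_le_of_norm_sub_le_one hr hs z
  have h3 := decayWeight_add_le_of_norm_sub_le_one hr hs (x + z)
  rw [← add_assoc, ← add_assoc] at h3
  have h4 : decayWeight r x ≤ 2 ^ r * decayWeight r x :=
    le_mul_of_one_le_left (decayWeight_pos x).le hA
  have p1 := decayWeight_pos (r := r) (s + z)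
  have p2 := decayWeight_pos (r := r) (s + x + z)
  have p3 := decayWeight_pos (r := r) (s₀ + x)
  have p4 := decayWeight_pos (r := r) x
  calc rectWeight r s x z
      ≤ (2 ^ r * decayWeight r (s₀ + x) + 2 ^ r * decayWeight r x) *
        (2 ^ r * decayWeight r (s₀ + z) + 2 ^ r * decayWeight r (s₀ + x + z)) := by
        unfold rectWeight
        gcongr
    _ = _ := by unfold rectWeight; ring

end Rectangle

lemma abs_kinIntegrand_sub_le {d : ℕ} {r : ℝ} (hr : 0 < r) {y y' : Rd d → ℝ} {M η : ℝ}
    (hM : 0 ≤ M) (hη : 0 ≤ η)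
    (hy : ∀ s, |y s| ≤ M * decayWeight r s) (hy' : ∀ s, |y' s| ≤ M * decayWeight r s)
    (hyy : ∀ s, |y s - y' s| ≤ η * decayWeight r s) {s x z : Rd d} (h : inner ℝ x z = 0) :
    |kinIntegrand d y s x z - kinIntegrand d y' s x z| ≤
      3 * M ^ 2 * η * ((1 + 2 ^ r) * 2 ^ r * decayWeight r s * rectWeight r s x z) := by
  have key : ∀ p q t : Rd d, |y p * y q * y t - y' p * y' q * y' t| ≤
      3 * M ^ 2 * η * (decayWeight r p * decayWeight r q * decayWeight r t) := by
    intro p q t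
    have hp := (decayWeight_pos (r := r) p).le
    have hq := (decayWeight_pos (r := r) q).le
    have ht := (decayWeight_pos (r := r) t).le
    calc |y p * y q * y t - y' p * y' q * y' t|
        = |(y p - y' p) * y q * y t + y' p * (y q - y' q) * y t + y' p * y' q * (y t - y' t)| := by
          ring_nf
      _ ≤ |y p - y' p| * |y q| * |y t| + |y' p| * |y q - y' q| * |y t|
          + |y' p| * |y' q| * |y t - y' t| := by
          refine (abs_add_three _ _ _).trans ?_
          simp only [abs_mul, le_refl]
      _ ≤ (η * decayWeight r p) * (M * decayWeight r q) * (M * decayWeight r t)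
          + (M * decayWeight r p) * (η * decayWeight r q) * (M * decayWeight r t)
          + (M * decayWeight r p) * (M * decayWeight r q) * (η * decayWeight r t) := by
          gcongr <;> first | apply hy | apply hy' | apply hyy
      _ = _ := by ring
  refine le_trans ?_ (mul_le_mul_of_nonneg_left (sum_vertex_products_le hr h) (by positivity))
  have k1 := abs_le.1 (key (s + x) (s + z) (s + x + z))
  have k2 := abs_le.1 (key (s + x) (s + z) s)
  have k3 := abs_le.1 (key (s + z) (s + x + z) s)
  have k4 := abs_le.1 (key (s + x) (s + x + z) s)
  unfold kinIntegrand
  rw [abs_le]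
  constructor <;> linarith [k1.1, k1.2, k2.1, k2.2, k3.1, k3.2, k4.1, k4.2]

section HyperplaneMeasurability

variable {d : ℕ}

lemma finrank_orthogonal_span_add_one {x : Rd d} (hx : x ≠ 0) :
    Module.finrank ℝ ((ℝ ∙ x)ᗮ : Submodule ℝ (Rd d)) + 1 = d := by
  have := Submodule.finrank_add_finrank_orthogonal (ℝ ∙ x)
  rw [finrank_span_singleton hx, finrank_euclideanSpace_fin] at this
  omega

/-- The orthogonal projection onto `x^⊥`, written as a measurable function of `(x, v)`. -/
def projPerp (x v : Rd d) : Rd d := v - (inner ℝ x v / ‖x‖ ^ 2) • x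

lemma measurable_projPerp : Measurable fun p : Rd d × Rd d => projPerp p.1 p.2 := by
  unfold projPerp
  fun_prop

lemma projPerp_add (x : Rd d) (k : (ℝ ∙ x : Submodule ℝ (Rd d)))
    (z : ((ℝ ∙ x)ᗮ : Submodule ℝ (Rd d))) : projPerp x ((k : Rd d) + z) = z := by
  obtain ⟨c, hc⟩ := Submodule.mem_span_singleton.1 k.2
  have hz : inner ℝ x (z : Rd d) = 0 := Submodule.mem_orthogonal_singleton_iff_inner_right.1 z.2
  rw [projPerp, ← hc, inner_add_right, hz, inner_smul_right, real_inner_self_eq_norm_sq]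
  rcases eq_or_ne x 0 with rfl | hx
  · simp
  · have : ‖x‖ ^ 2 ≠ 0 := by simpa using hx
    rw [add_zero, mul_div_assoc, div_self this]
    simp

/-- Thickening the hyperplane `x^⊥` by a unit ball in the direction `x` turns integrals over
`x^⊥` into integrals over the whole space. -/
lemma integral_projPerp {x : Rd d} (hx : x ≠ 0) (f : Rd d → ℝ) :
    ∫ v : Rd d, (Metric.ball (0 : Rd d) 1).indicator 1 (v - projPerp x v) * f (projPerp x v)
      = volume.real (Metric.ball (0 : Rd 1) 1) * hyperplaneIntegral d x f := by
  set K : Submodule ℝ (Rd d) := ℝ ∙ x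
  have hmp : MeasurePreserving
      (fun p : K × Kᗮ => K.orthogonalDecomposition.symm (WithLp.toLp 2 p)) :=
    K.orthogonalDecomposition.symm.measurePreserving.comp (WithLp.volume_preserving_toLp K Kᗮ)
  have hemb : MeasurableEmbedding
      (fun p : K × Kᗮ => K.orthogonalDecomposition.symm (WithLp.toLp 2 p)) :=
    K.orthogonalDecomposition.symm.toHomeomorph.measurableEmbedding.comp
      (MeasurableEquiv.toLp 2 (K × Kᗮ)).measurableEmbedding
  have happ : ∀ p : K × Kᗮ,
      K.orthogonalDecomposition.symm (WithLp.toLp 2 p) = (p.1 : Rd d) + p.2 := by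
    intro p
    simp
  rw [← hmp.integral_comp hemb]
  have hball : ∫ k : K, (Metric.ball (0 : K) 1).indicator (1 : K → ℝ) k
      = volume.real (Metric.ball (0 : Rd 1) 1) := by
    rw [integral_indicator_one Metric.isOpen_ball.measurableSet]
    have hK : Module.finrank ℝ K = 1 := finrank_span_singleton hx
    have : Nontrivial K := Module.nontrivial_of_finrank_pos (R := ℝ) (by omega)
    have : Nontrivial (Rd 1) := Module.nontrivial_of_finrank_pos (R := ℝ) (by simp)
    simp only [Measure.real, InnerProductSpace.volume_ball, hK, finrank_euclideanSpace_fin]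
  rw [← hball, hyperplaneIntegral,
    ← integral_prod_mul ((Metric.ball (0 : K) 1).indicator (1 : K → ℝ))
      (fun z : Kᗮ => f (z : Rd d))]
  refine integral_congr_ae (Filter.Eventually.of_forall fun p => ?_)
  simp only [happ]
  rw [projPerp_add, add_sub_cancel_right]
  congr 1

lemma stronglyMeasurable_inv_norm_mul_hyperplaneIntegral {f : Rd d → Rd d → ℝ}
    (hf : Measurable fun p : Rd d × Rd d => f p.1 p.2) :
    StronglyMeasurable fun x => ‖x‖⁻¹ * hyperplaneIntegral d x (f x) := by
  have hc : volume.real (Metric.ball (0 : Rd 1) 1) ≠ 0 :=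
    (ENNReal.toReal_pos (Metric.measure_ball_pos volume _ one_pos).ne' measure_ball_lt_top.ne).ne'
  have heq : (fun x => ‖x‖⁻¹ * hyperplaneIntegral d x (f x)) = fun x : Rd d => ‖x‖⁻¹ *
      ((volume.real (Metric.ball (0 : Rd 1) 1))⁻¹ * ∫ v : Rd d,
        (Metric.ball (0 : Rd d) 1).indicator 1 (v - projPerp x v) * f x (projPerp x v)) := by
    funext x
    rcases eq_or_ne x 0 with rfl | hx
    · simp
    · rw [integral_projPerp hx, inv_mul_cancel_left₀ hc]
  rw [heq]
  refine (Measurable.stronglyMeasurable (by fun_prop)).mul (StronglyMeasurable.const_mul ?_ _)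
  refine StronglyMeasurable.integral_prod_right (Measurable.stronglyMeasurable ?_)
  refine Measurable.mul ?_ ?_
  · exact (measurable_one.indicator Metric.isOpen_ball.measurableSet).comp
      (measurable_snd.sub measurable_projPerp)
  · exact hf.comp (measurable_fst.prodMk measurable_projPerp)

end HyperplaneMeasurability

section WeightIntegrals

variable {d : ℕ} {r : ℝ}

lemma integrable_decayWeight (hr : (d : ℝ) < r) : Integrable (decayWeight r : Rd d → ℝ) :=
  integrable_one_add_norm (by simpa using hr)

lemma decayWeight_add_le_perp (hr : 0 < r) (V : Submodule ℝ (Rd d)) (p : Rd d) (z : V) :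
    decayWeight r (p + z) ≤ decayWeight r (V.orthogonalProjectionOnto p + z) := by
  refine decayWeight_anti hr ?_
  have h := V.norm_orthogonalProjectionOnto_apply_le (p + z)
  rwa [map_add, Submodule.orthogonalProjectionOnto_mem_subspace_eq_self] at h

lemma integrable_decayWeight_submodule (hr : (d : ℝ) < r) (V : Submodule ℝ (Rd d)) :
    Integrable (decayWeight r : V → ℝ) := by
  refine integrable_one_add_norm (lt_of_le_of_lt ?_ hr)
  have := V.finrank_le
  rw [finrank_euclideanSpace_fin] at this
  exact_mod_cast this

lemma integrable_decayWeight_add_submodule (hr : (d : ℝ) < r) (V : Submodule ℝ (Rd d))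
    (p : Rd d) : Integrable fun z : V => decayWeight r (p + z) := by
  have hr0 : 0 < r := (Nat.cast_nonneg d).trans_lt hr
  refine ((integrable_decayWeight_submodule hr V).comp_add_left
    (V.orthogonalProjectionOnto p)).mono' ?_ (Filter.Eventually.of_forall fun z => ?_)
  · exact (continuous_decayWeight.comp (by fun_prop)).aestronglyMeasurable
  · rw [Real.norm_of_nonneg (decayWeight_pos _).le]
    exact decayWeight_add_le_perp hr0 V p z

lemma integral_decayWeight_eq {F : Type*} [NormedAddCommGroup F] [InnerProductSpace ℝ F]
    [FiniteDimensional ℝ F] [MeasurableSpace F] [BorelSpace F] {n : ℕ}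
    (h : Module.finrank ℝ F = n) :
    ∫ v : F, decayWeight r v = ∫ v : Rd n, decayWeight r v := by
  subst h
  rw [← (stdOrthonormalBasis ℝ F).measurePreserving_repr.integral_comp
    (stdOrthonormalBasis ℝ F).repr.toHomeomorph.measurableEmbedding]
  simp [decayWeight]

lemma integral_decayWeight_add_submodule_le (hr : (d : ℝ) < r) (V : Submodule ℝ (Rd d))
    (p : Rd d) : ∫ z : V, decayWeight r (p + z) ≤ ∫ z : V, decayWeight r z := by
  have hr0 : 0 < r := (Nat.cast_nonneg d).trans_lt hr
  rw [← integral_add_left_eq_self (decayWeight r) (V.orthogonalProjectionOnto p)]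
  exact integral_mono (integrable_decayWeight_add_submodule hr V p)
    ((integrable_decayWeight_submodule hr V).comp_add_left _)
    (decayWeight_add_le_perp hr0 V p)

lemma hyperplaneIntegral_decayWeight_add_le (hr : (d : ℝ) < r) {x : Rd d} (hx : x ≠ 0)
    (p : Rd d) :
    hyperplaneIntegral d x (fun z => decayWeight r (p + z)) ≤
      ∫ v : Rd (d - 1), decayWeight r v := by
  have hfin : Module.finrank ℝ ((ℝ ∙ x)ᗮ : Submodule ℝ (Rd d)) = d - 1 := by
    have := finrank_orthogonal_span_add_one hx
    omega
  rw [← integral_decayWeight_eq hfin]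
  exact integral_decayWeight_add_submodule_le hr _ p

lemma integrable_rectWeight (hr : (d : ℝ) < r) (V : Submodule ℝ (Rd d)) (s x : Rd d) :
    Integrable fun z : V => rectWeight r s x (z : Rd d) :=
  ((integrable_decayWeight_add_submodule hr V s).add
    (integrable_decayWeight_add_submodule hr V (s + x))).const_mul _

lemma hyperplaneIntegral_rectWeight_le (hr : (d : ℝ) < r) {x : Rd d} (hx : x ≠ 0) (s : Rd d) :
    hyperplaneIntegral d x (rectWeight r s x) ≤
      (decayWeight r (s + x) + decayWeight r x) * (2 * ∫ v : Rd (d - 1), decayWeight r v) := by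
  have h1 := hyperplaneIntegral_decayWeight_add_le hr hx s
  have h2 := hyperplaneIntegral_decayWeight_add_le hr hx (s + x)
  have p1 := decayWeight_pos (r := r) (s + x)
  have p2 := decayWeight_pos (r := r) x
  unfold hyperplaneIntegral at *
  unfold rectWeight
  rw [integral_const_mul, integral_add (integrable_decayWeight_add_submodule hr _ s)
    (integrable_decayWeight_add_submodule hr _ (s + x))]
  gcongr
  linarith

lemma integrable_indicator_inv_norm (hd : 2 ≤ d) :
    Integrable ((Metric.ball (0 : Rd d) 1).indicator fun x => ‖x‖⁻¹) := by
  rw [integrable_indicator_iff Metric.isOpen_ball.measurableSet]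
  refine integrableOn_ball_of_norm_le_rpow (C := 1) (α := 1) ?_ ?_ ?_ ?_
  · simp; omega
  · simp only [finrank_euclideanSpace_fin, Nat.one_lt_cast]; omega
  · exact Filter.Eventually.of_forall fun x => by simp [Real.rpow_neg_one]
  · exact Measurable.aestronglyMeasurable (by fun_prop)

/-- An integrable majorant of `|x|⁻¹ (w(s+x) + w(x))`, with integral independent of `s`. -/
def outerMajorant (r : ℝ) (s x : Rd d) : ℝ :=
  2 * (Metric.ball (0 : Rd d) 1).indicator (fun x => ‖x‖⁻¹) x
    + (decayWeight r (s + x) + decayWeight r x)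

lemma inv_norm_mul_le_outerMajorant (hr : 0 < r) (s x : Rd d) :
    ‖x‖⁻¹ * (decayWeight r (s + x) + decayWeight r x) ≤ outerMajorant r s x := by
  have p1 := decayWeight_pos (r := r) (s + x)
  have p2 := decayWeight_pos (r := r) x
  have l1 := decayWeight_le_one hr (s + x)
  have l2 := decayWeight_le_one hr x
  have hn : 0 ≤ ‖x‖⁻¹ := by positivity
  unfold outerMajorant
  by_cases hx : x ∈ Metric.ball (0 : Rd d) 1
  · rw [Set.indicator_of_mem hx]
    nlinarith
  · rw [Set.indicator_of_notMem hx]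
    have : 1 ≤ ‖x‖ := by simpa using hx
    have := inv_le_one_of_one_le₀ this
    nlinarith

lemma integrable_outerMajorant (hd : 2 ≤ d) (hr : (d : ℝ) < r) (s : Rd d) :
    Integrable (outerMajorant r s) :=
  ((integrable_indicator_inv_norm hd).const_mul 2).add
    (((integrable_decayWeight hr).comp_add_left s).add (integrable_decayWeight hr))

lemma integral_outerMajorant (hd : 2 ≤ d) (hr : (d : ℝ) < r) (s : Rd d) :
    ∫ x, outerMajorant r s x = ∫ x : Rd d, outerMajorant r 0 x := by
  have h1 := (integrable_indicator_inv_norm hd).const_mul 2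
  have h2 := integrable_decayWeight hr
  have h3 : ∀ t : Rd d, ∫ x, outerMajorant r t x =
      (∫ x : Rd d, 2 * (Metric.ball (0 : Rd d) 1).indicator (fun x => ‖x‖⁻¹) x)
        + ((∫ x : Rd d, decayWeight r x) + ∫ x : Rd d, decayWeight r x) := by
    intro t
    unfold outerMajorant
    have h4 := h2.comp_add_left t
    have h5 : Integrable fun x => decayWeight r (t + x) + decayWeight r x := h4.add h2
    rw [integral_add h1 h5, integral_add h4 h2, integral_add_left_eq_self (decayWeight r) t]
  rw [h3, h3]

end WeightIntegrals

section WaveKinetic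

variable {d : ℕ} {r : ℝ}

lemma inner_eq_zero_of_mem_perp {x : Rd d} (z : ((ℝ ∙ x)ᗮ : Submodule ℝ (Rd d))) :
    inner ℝ x (z : Rd d) = 0 :=
  Submodule.mem_orthogonal_singleton_iff_inner_right.1 z.2

lemma outerMajorant_nonneg (hr : 0 < r) (s x : Rd d) : 0 ≤ outerMajorant r s x :=
  (mul_nonneg (by positivity)
    (add_pos (decayWeight_pos _) (decayWeight_pos _)).le).trans
    (inv_norm_mul_le_outerMajorant hr s x)

lemma integral_decayWeight_nonneg (n : ℕ) : 0 ≤ ∫ v : Rd n, decayWeight r v :=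
  integral_nonneg fun v => (decayWeight_pos v).le

lemma abs_inv_norm_mul_hyperplaneIntegral_le (hr : (d : ℝ) < r) {f : Rd d → ℝ} {c : ℝ}
    (hc : 0 ≤ c) {s x : Rd d} (hf : ∀ z, inner ℝ x z = 0 → |f z| ≤ c * rectWeight r s x z) :
    |‖x‖⁻¹ * hyperplaneIntegral d x f| ≤
      c * (2 * ∫ v : Rd (d - 1), decayWeight r v) * outerMajorant r s x := by
  have hr0 : 0 < r := (Nat.cast_nonneg d).trans_lt hr
  have hJ := integral_decayWeight_nonneg (r := r) (d - 1)
  have hout := outerMajorant_nonneg hr0 s x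
  rcases eq_or_ne x 0 with rfl | hx
  · simp only [norm_zero, inv_zero, zero_mul, abs_zero]
    positivity
  have h1 : |hyperplaneIntegral d x f| ≤ c * hyperplaneIntegral d x (rectWeight r s x) := by
    unfold hyperplaneIntegral
    rw [← integral_const_mul, ← Real.norm_eq_abs]
    exact norm_integral_le_of_norm_le ((integrable_rectWeight hr _ s x).const_mul c)
      (Filter.Eventually.of_forall fun z => hf z (inner_eq_zero_of_mem_perp z))
  have h2 := hyperplaneIntegral_rectWeight_le hr hx s
  have h3 := inv_norm_mul_le_outerMajorant hr0 s x
  rw [abs_mul, abs_of_nonneg (by positivity : 0 ≤ ‖x‖⁻¹)]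
  calc ‖x‖⁻¹ * |hyperplaneIntegral d x f|
      ≤ ‖x‖⁻¹ * (c * ((decayWeight r (s + x) + decayWeight r x)
          * (2 * ∫ v : Rd (d - 1), decayWeight r v))) := by
        gcongr
        exact h1.trans (by gcongr)
    _ = c * (2 * ∫ v : Rd (d - 1), decayWeight r v)
          * (‖x‖⁻¹ * (decayWeight r (s + x) + decayWeight r x)) := by ring
    _ ≤ _ := by gcongr

lemma integrable_inv_norm_mul_hyperplaneIntegral (hd : 2 ≤ d) (hr : (d : ℝ) < r)
    {f : Rd d → Rd d → ℝ} (hfm : Measurable fun p : Rd d × Rd d => f p.1 p.2) {c : ℝ}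
    (hc : 0 ≤ c) {s : Rd d}
    (hf : ∀ x z, inner ℝ x z = 0 → |f x z| ≤ c * rectWeight r s x z) :
    Integrable fun x => ‖x‖⁻¹ * hyperplaneIntegral d x (f x) :=
  ((integrable_outerMajorant hd hr s).const_mul _).mono'
    (stronglyMeasurable_inv_norm_mul_hyperplaneIntegral hfm).aestronglyMeasurable
    (Filter.Eventually.of_forall fun x => abs_inv_norm_mul_hyperplaneIntegral_le hr hc (hf x))

lemma abs_integral_hyperplaneIntegral_le (hd : 2 ≤ d) (hr : (d : ℝ) < r)
    {f : Rd d → Rd d → ℝ} {c : ℝ} (hc : 0 ≤ c) {s : Rd d}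
    (hf : ∀ x z, inner ℝ x z = 0 → |f x z| ≤ c * rectWeight r s x z) :
    |∫ x, ‖x‖⁻¹ * hyperplaneIntegral d x (f x)| ≤
      c * (2 * ∫ v : Rd (d - 1), decayWeight r v) * ∫ x : Rd d, outerMajorant r 0 x := by
  rw [← integral_outerMajorant hd hr s, ← integral_const_mul, ← Real.norm_eq_abs]
  exact norm_integral_le_of_norm_le ((integrable_outerMajorant hd hr s).const_mul _)
    (Filter.Eventually.of_forall fun x => abs_inv_norm_mul_hyperplaneIntegral_le hr hc (hf x))

lemma abs_kinIntegrand_le (hr : 0 < r) {y : Rd d → ℝ} {M : ℝ} (hM : 0 ≤ M)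
    (hy : ∀ s, |y s| ≤ M * decayWeight r s) {s x z : Rd d} (h : inner ℝ x z = 0) :
    |kinIntegrand d y s x z| ≤
      3 * M ^ 2 * M * ((1 + 2 ^ r) * 2 ^ r * decayWeight r s) * rectWeight r s x z := by
  have h0 : ∀ s : Rd d, |(0 : ℝ)| ≤ M * decayWeight r s := fun s => by
    rw [abs_zero]
    exact mul_nonneg hM (decayWeight_pos s).le
  have := abs_kinIntegrand_sub_le (y' := fun _ => 0) (s := s) hr hM hM hy h0 (by simpa using hy) h
  rw [mul_assoc (3 * M ^ 2 * M)]
  simpa [kinIntegrand] using this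

lemma continuous_kinIntegrand {y : Rd d → ℝ} (hy : Continuous y) :
    Continuous fun p : Rd d × Rd d × Rd d => kinIntegrand d y p.1 p.2.1 p.2.2 := by
  unfold kinIntegrand
  fun_prop

lemma measurable_kinIntegrand {y : Rd d → ℝ} (hy : Continuous y) (s : Rd d) :
    Measurable fun p : Rd d × Rd d => kinIntegrand d y s p.1 p.2 :=
  ((continuous_kinIntegrand hy).comp (by fun_prop : Continuous fun p : Rd d × Rd d =>
    (s, p.1, p.2))).measurable

lemma integrable_kinIntegrand_perp (hr : (d : ℝ) < r) {y : Rd d → ℝ} (hyc : Continuous y)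
    {M : ℝ} (hM : 0 ≤ M) (hy : ∀ s, |y s| ≤ M * decayWeight r s) (s x : Rd d) :
    Integrable fun z : ((ℝ ∙ x)ᗮ : Submodule ℝ (Rd d)) => kinIntegrand d y s x z := by
  have hr0 : 0 < r := (Nat.cast_nonneg d).trans_lt hr
  refine ((integrable_rectWeight hr _ s x).const_mul _).mono' ?_
    (Filter.Eventually.of_forall fun z =>
      abs_kinIntegrand_le hr0 hM hy (inner_eq_zero_of_mem_perp z))
  exact ((continuous_kinIntegrand hyc).comp (by fun_prop :
    Continuous fun z : ((ℝ ∙ x)ᗮ : Submodule ℝ (Rd d)) =>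
      (s, x, (z : Rd d)))).aestronglyMeasurable

/-- The wave kinetic integral is locally Lipschitz in the weighted sup-norm. -/
lemma exists_abs_Kwk_sub_le (hd : 2 ≤ d) (hr : (d : ℝ) < r) :
    ∃ C : ℝ, 0 < C ∧ ∀ (y y' : Rd d → ℝ) (M η : ℝ), Continuous y → Continuous y' → 0 ≤ M →
      0 ≤ η → (∀ s, |y s| ≤ M * decayWeight r s) → (∀ s, |y' s| ≤ M * decayWeight r s) →
      (∀ s, |y s - y' s| ≤ η * decayWeight r s) →
      ∀ s, |Kwk d y s - Kwk d y' s| ≤ C * M ^ 2 * η * decayWeight r s := by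
  have hr0 : 0 < r := (Nat.cast_nonneg d).trans_lt hr
  have hJ := integral_decayWeight_nonneg (r := r) (d - 1)
  have hO : 0 ≤ ∫ x : Rd d, outerMajorant r 0 x :=
    integral_nonneg fun x => outerMajorant_nonneg hr0 0 x
  set J := ∫ v : Rd (d - 1), decayWeight r v
  set O := ∫ x : Rd d, outerMajorant r 0 x
  refine ⟨2 * Real.pi * (3 * ((1 + 2 ^ r) * 2 ^ r) * (2 * J) * O) + 1, by positivity, ?_⟩
  intro y y' M η hyc hyc' hM hη hy hy' hyy s
  have hw := decayWeight_pos (r := r) s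
  have hint : ∀ v : Rd d → ℝ, Continuous v → (∀ s, |v s| ≤ M * decayWeight r s) →
      Integrable fun x => ‖x‖⁻¹ * hyperplaneIntegral d x (kinIntegrand d v s x) :=
    fun v hvc hv => integrable_inv_norm_mul_hyperplaneIntegral hd hr
      (measurable_kinIntegrand hvc s) (by positivity)
      fun x z h => abs_kinIntegrand_le hr0 hM hv h
  have hsub : Kwk d y s - Kwk d y' s = 2 * Real.pi * ∫ x : Rd d, ‖x‖⁻¹ *
      hyperplaneIntegral d x (fun z => kinIntegrand d y s x z - kinIntegrand d y' s x z) := by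
    rw [Kwk, Kwk, ← mul_sub, ← integral_sub (hint y hyc hy) (hint y' hyc' hy')]
    congr 2
    funext x
    rw [← mul_sub, hyperplaneIntegral, hyperplaneIntegral, hyperplaneIntegral,
      ← integral_sub (integrable_kinIntegrand_perp hr hyc hM hy s x)
        (integrable_kinIntegrand_perp hr hyc' hM hy' s x)]
  have hbound := abs_integral_hyperplaneIntegral_le hd hr (s := s)
    (f := fun x z => kinIntegrand d y s x z - kinIntegrand d y' s x z)
    (c := 3 * M ^ 2 * η * ((1 + 2 ^ r) * 2 ^ r * decayWeight r s)) (by positivity)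
    (fun x z h => by
      rw [mul_assoc (3 * M ^ 2 * η)]
      exact abs_kinIntegrand_sub_le hr0 hM hη hy hy' hyy h)
  rw [hsub, abs_mul, abs_of_pos Real.two_pi_pos]
  calc _ ≤ 2 * Real.pi * (3 * M ^ 2 * η * ((1 + 2 ^ r) * 2 ^ r * decayWeight r s)
        * (2 * J) * O) := by gcongr
    _ = 2 * Real.pi * (3 * ((1 + 2 ^ r) * 2 ^ r) * (2 * J) * O) * (M ^ 2 * η * decayWeight r s) := by
        ring
    _ ≤ (2 * Real.pi * (3 * ((1 + 2 ^ r) * 2 ^ r) * (2 * J) * O) + 1)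
        * (M ^ 2 * η * decayWeight r s) := by
        gcongr
        linarith
    _ = _ := by ring

lemma continuous_Kwk (hd : 2 ≤ d) (hr : (d : ℝ) < r) {y : Rd d → ℝ} (hyc : Continuous y)
    {M : ℝ} (hM : 0 ≤ M) (hy : ∀ s, |y s| ≤ M * decayWeight r s) : Continuous (Kwk d y) := by
  have hr0 : 0 < r := (Nat.cast_nonneg d).trans_lt hr
  rw [continuous_iff_continuousAt]
  intro s₀
  have hnear : ∀ᶠ s in nhds s₀, ‖s - s₀‖ ≤ 1 := by
    filter_upwards [Metric.closedBall_mem_nhds s₀ one_pos] with s hs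
    rwa [← dist_eq_norm]
  have hbound : ∀ s, ‖s - s₀‖ ≤ 1 → ∀ x z : Rd d, inner ℝ x z = 0 →
      |kinIntegrand d y s x z| ≤
        3 * M ^ 2 * M * ((1 + 2 ^ r) * 2 ^ r) * (2 ^ r * 2 ^ r) * rectWeight r s₀ x z := by
    intro s hs x z h
    have h1 := abs_kinIntegrand_le (s := s) hr0 hM hy h
    have h2 := rectWeight_le_of_norm_sub_le_one hr0 hs x z
    have h3 := rectWeight_nonneg (r := r) s x z
    have h4 := decayWeight_le_one hr0 s
    calc |kinIntegrand d y s x z|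
        ≤ 3 * M ^ 2 * M * ((1 + 2 ^ r) * 2 ^ r * decayWeight r s) * rectWeight r s x z := h1
      _ ≤ 3 * M ^ 2 * M * ((1 + 2 ^ r) * 2 ^ r * 1)
            * (2 ^ r * 2 ^ r * rectWeight r s₀ x z) := by gcongr
      _ = _ := by ring
  refine ContinuousAt.mul continuousAt_const (continuousAt_of_dominated
    (Filter.Eventually.of_forall fun s => (stronglyMeasurable_inv_norm_mul_hyperplaneIntegral
      (measurable_kinIntegrand hyc s)).aestronglyMeasurable)
    (hnear.mono fun s hs => Filter.Eventually.of_forall fun x =>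
      abs_inv_norm_mul_hyperplaneIntegral_le hr (by positivity) (hbound s hs x))
    ((integrable_outerMajorant hd hr s₀).const_mul _)
    (Filter.Eventually.of_forall fun x => ContinuousAt.mul continuousAt_const ?_))
  refine continuousAt_of_dominated (Filter.Eventually.of_forall fun s =>
      (integrable_kinIntegrand_perp hr hyc hM hy s x).aestronglyMeasurable)
    (hnear.mono fun s hs => Filter.Eventually.of_forall fun z =>
      hbound s hs x z (inner_eq_zero_of_mem_perp z))
    ((integrable_rectWeight hr _ s₀ x).const_mul _)
    (Filter.Eventually.of_forall fun z => ?_)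
  exact ((continuous_kinIntegrand hyc).comp (by fun_prop : Continuous fun s : Rd d =>
    (s, x, (z : Rd d)))).continuousAt

lemma Kwk_zero (s : Rd d) : Kwk d (fun _ => 0) s = 0 := by
  simp [Kwk, hyperplaneIntegral, kinIntegrand]

end WaveKinetic

section SteadyState

open scoped BoundedContinuousFunction

variable {d : ℕ} {r rstar : ℝ}

lemma memCr_iff {y : Rd d → ℝ} :
    memCr d r y ↔ Continuous y ∧ ∃ M, ∀ s, |y s| ≤ M * decayWeight r s := by
  simp only [memCr, rpow_mul_le_iff]

lemma wNorm_le_iff {y : Rd d → ℝ} (hy : memCr d r y) {M : ℝ} :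
    wNorm d r y ≤ M ↔ ∀ s, |y s| ≤ M * decayWeight r s := by
  simp only [← rpow_mul_le_iff]
  obtain ⟨-, K, hK⟩ := hy
  exact ciSup_le_iff ⟨K, by rintro _ ⟨s, rfl⟩; exact hK s⟩

lemma memCr.sub {y y' : Rd d → ℝ} (hy : memCr d r y) (hy' : memCr d r y') :
    memCr d r fun s => y s - y' s := by
  rw [memCr_iff] at *
  obtain ⟨hc, M, hM⟩ := hy
  obtain ⟨hc', M', hM'⟩ := hy'
  refine ⟨hc.sub hc', M + M', fun s => ?_⟩
  rw [add_mul]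
  exact (abs_sub _ _).trans (add_le_add (hM s) (hM' s))

/-- The function of `C_r` obtained by weighting a bounded continuous function. -/
def weighted (r : ℝ) (u : Rd d →ᵇ ℝ) (s : Rd d) : ℝ := u s * decayWeight r s

lemma continuous_weighted (u : Rd d →ᵇ ℝ) : Continuous (weighted r u) :=
  u.continuous.mul continuous_decayWeight

lemma abs_weighted_sub_le (u v : Rd d →ᵇ ℝ) (s : Rd d) :
    |weighted r u s - weighted r v s| ≤ dist u v * decayWeight r s := by
  have hw := decayWeight_pos (r := r) s
  rw [weighted, weighted, ← sub_mul, abs_mul, abs_of_pos hw]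
  gcongr
  exact u.dist_coe_le_dist s

lemma dist_le_of_abs_weighted_sub_le {u v : Rd d →ᵇ ℝ} {M : ℝ}
    (h : ∀ s, |weighted r u s - weighted r v s| ≤ M * decayWeight r s) : dist u v ≤ M := by
  have key : ∀ s, dist (u s) (v s) ≤ M := fun s => by
    have hw := decayWeight_pos (r := r) s
    have := h s
    rw [weighted, weighted, ← sub_mul, abs_mul, abs_of_pos hw] at this
    exact le_of_mul_le_mul_right this hw
  exact (BoundedContinuousFunction.dist_le (dist_nonneg.trans (key 0))).2 key

lemma abs_weighted_le {u : Rd d →ᵇ ℝ} {M : ℝ} (h : ‖u‖ ≤ M) (s : Rd d) :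
    |weighted r u s| ≤ M * decayWeight r s := by
  have := abs_weighted_sub_le (r := r) u 0 s
  simp only [weighted, BoundedContinuousFunction.coe_zero, Pi.zero_apply, zero_mul, sub_zero,
    dist_zero_right] at this
  exact this.trans (mul_le_mul_of_nonneg_right h (decayWeight_pos s).le)

lemma memCr_weighted (u : Rd d →ᵇ ℝ) : memCr d r (weighted r u) :=
  memCr_iff.2 ⟨continuous_weighted u, ‖u‖, abs_weighted_le le_rfl⟩

lemma memCr.exists_weighted_eq {y : Rd d → ℝ} (hy : memCr d r y) :
    ∃ u : Rd d →ᵇ ℝ, weighted r u = y := by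
  obtain ⟨hc, K, hK⟩ := hy
  have hcont : Continuous fun s : Rd d => (1 + ‖s‖) ^ r * y s :=
    ((by fun_prop : Continuous fun s : Rd d => 1 + ‖s‖).rpow_const
      fun s => Or.inl (by positivity)).mul hc
  refine ⟨.ofNormedAddCommGroup _ hcont K fun s => ?_, ?_⟩
  · rw [Real.norm_eq_abs, abs_mul, abs_of_nonneg (by positivity)]
    exact hK s
  · funext s
    simp only [weighted, BoundedContinuousFunction.coe_ofNormedAddCommGroup]
    rw [mul_right_comm, rpow_mul_decayWeight, one_mul]

lemma one_le_gam (h : 0 < rstar) (s : Rd d) : 1 ≤ gam d rstar s :=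
  Real.one_le_rpow (by nlinarith [norm_nonneg s]) h.le

lemma continuous_gam : Continuous (gam d rstar) := by
  unfold gam
  exact (by fun_prop : Continuous fun s : Rd d => 1 + ‖s‖ ^ 2).rpow_const
    fun s => Or.inl (by positivity)

lemma memCr.div_gam (h : 0 < rstar) {y : Rd d → ℝ} (hy : memCr d r y) :
    memCr d r fun s => y s / gam d rstar s := by
  rw [memCr_iff] at *
  obtain ⟨hc, M, hM⟩ := hy
  refine ⟨hc.div continuous_gam fun s => (zero_lt_one.trans_le (one_le_gam h s)).ne',
    M, fun s => ?_⟩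
  have hg := one_le_gam h s
  rw [abs_div, abs_of_pos (zero_lt_one.trans_le hg)]
  exact (div_le_self (abs_nonneg _) hg).trans (hM s)

lemma memCr_schwartz_sq (b : SchwartzMap (Rd d) ℝ) : memCr d r fun s => b s ^ 2 := by
  refine ⟨b.continuous.pow 2, ?_⟩
  obtain ⟨n, hn⟩ := exists_nat_ge r
  set A := 2 ^ n * (Finset.Iic (n, 0)).sup (fun m => SchwartzMap.seminorm ℝ m.1 m.2) b
  have hA : ∀ s, (1 + ‖s‖) ^ n * |b s| ≤ A := fun s => by
    simpa using SchwartzMap.one_add_le_sup_seminorm_apply (𝕜 := ℝ) (m := (n, 0)) le_rfl le_rfl b s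
  refine ⟨A * A, fun s => ?_⟩
  have h1 : (1 : ℝ) ≤ 1 + ‖s‖ := by linarith [norm_nonneg s]
  have h2 : (1 + ‖s‖) ^ r ≤ (1 + ‖s‖) ^ n := by
    rw [← Real.rpow_natCast]
    exact Real.rpow_le_rpow_of_exponent_le h1 hn
  have h3 : |b s| ≤ A :=
    (le_mul_of_one_le_left (abs_nonneg _) (one_le_pow₀ h1)).trans (hA s)
  calc (1 + ‖s‖) ^ r * |b s ^ 2| = (1 + ‖s‖) ^ r * |b s| * |b s| := by rw [abs_pow]; ring
    _ ≤ (1 + ‖s‖) ^ n * |b s| * |b s| := by gcongr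
    _ ≤ A * A := mul_le_mul (hA s) h3 (abs_nonneg _) ((abs_nonneg _).trans h3)

lemma steadyState_iff (h : 0 < rstar) (b : Rd d → ℝ) (ε : ℝ) (y : Rd d → ℝ) (s : Rd d) :
    -2 * gam d rstar s * y s + 2 * b s ^ 2 + ε * Kwk d y s = 0 ↔
      y s = b s ^ 2 / gam d rstar s + ε / 2 * (Kwk d y s / gam d rstar s) := by
  have hg := (zero_lt_one.trans_le (one_le_gam h s)).ne'
  constructor
  · intro heq
    field_simp
    linarith
  · intro heq
    field_simp at heq
    linarith

end SteadyState

/-- With `m⁰(s) = b(s)²/γ_s`, there exist `ε_* > 0`, `δ > 0` and `C > 0`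
such that for every `ε ∈ [0, ε_*]` there is exactly one `y ∈ C_r(ℝ^d)` with
`‖y − m⁰‖_r ≤ δ` solving the steady-state equation, and it satisfies `‖y − m⁰‖_r ≤ C ε`. -/
theorem statement9 (d : ℕ) (hd : 2 ≤ d) (r : ℝ) (hr : (d : ℝ) < r)
    (rstar : ℝ) (hrstar : 0 < rstar)
    (b : SchwartzMap (Rd d) ℝ) (hb : ∀ s, 0 < b s) :
    ∃ εstar : ℝ, 0 < εstar ∧ ∃ δ : ℝ, 0 < δ ∧ ∃ C : ℝ, 0 < C ∧
      ∀ ε ∈ Set.Icc (0 : ℝ) εstar,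
        ∃ y : Rd d → ℝ,
          (IsSteadyState d r rstar (⇑b) ε y ∧
            wNorm d r (fun s => y s - (b s) ^ 2 / gam d rstar s) ≤ δ) ∧
          wNorm d r (fun s => y s - (b s) ^ 2 / gam d rstar s) ≤ C * ε ∧
          (∀ y' : Rd d → ℝ, IsSteadyState d r rstar (⇑b) ε y' →
            wNorm d r (fun s => y' s - (b s) ^ 2 / gam d rstar s) ≤ δ →
            ∀ s : Rd d, y' s = y s) := by
  have hr0 : 0 < r := (Nat.cast_nonneg d).trans_lt hr
  obtain ⟨L, hL, hlip⟩ := exists_abs_Kwk_sub_le hd hr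
  have hm : memCr d r fun s => b s ^ 2 / gam d rstar s :=
    memCr.div_gam hrstar (memCr_schwartz_sq b)
  obtain ⟨u₀, hu₀⟩ := hm.exists_weighted_eq
  set M := ‖u₀‖ + 1
  have hM1 : 1 ≤ M := by simp [M]
  have hlipw : ∀ u v : BoundedContinuousFunction (Rd d) ℝ, ∀ N : ℝ, ‖u‖ ≤ N → ‖v‖ ≤ N → ∀ s,
      |Kwk d (weighted r u) s - Kwk d (weighted r v) s| ≤
        L * N ^ 2 * dist u v * decayWeight r s := fun u v N hu hv =>
    hlip _ _ N _ (continuous_weighted u) (continuous_weighted v) ((norm_nonneg u).trans hu)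
      dist_nonneg (abs_weighted_le hu) (abs_weighted_le hv) (abs_weighted_sub_le u v)
  have hKw : ∀ u : BoundedContinuousFunction (Rd d) ℝ, ∀ N : ℝ, ‖u‖ ≤ N → ∀ s,
      |Kwk d (weighted r u) s| ≤ L * N ^ 2 * N * decayWeight r s := by
    intro u N hu s
    have h0 : weighted r (0 : BoundedContinuousFunction (Rd d) ℝ) = fun _ : Rd d => 0 := by
      funext s
      simp [weighted]
    have hN := (norm_nonneg u).trans hu
    have := hlipw u 0 N hu (by simpa using hN) s
    rw [h0, Kwk_zero, sub_zero, dist_zero_right] at this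
    have hw := decayWeight_pos (r := r) s
    exact this.trans (by gcongr)
  have hK : ∀ u : BoundedContinuousFunction (Rd d) ℝ,
      ∃ v : BoundedContinuousFunction (Rd d) ℝ,
        weighted r v = fun s => Kwk d (weighted r u) s / gam d rstar s := fun u =>
    ((memCr_iff.2 ⟨continuous_Kwk hd hr (continuous_weighted u) (norm_nonneg u)
      (abs_weighted_le le_rfl), _, hKw u _ le_rfl⟩).div_gam hrstar).exists_weighted_eq
  choose Q hQ using hK
  have hQlip : ∀ u v, ‖u‖ ≤ M → ‖v‖ ≤ M → dist (Q u) (Q v) ≤ L * M ^ 2 * dist u v := by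
    intro u v hu hv
    refine dist_le_of_abs_weighted_sub_le (r := r) fun s => ?_
    have hg := one_le_gam hrstar s
    rw [hQ, hQ, ← sub_div, abs_div, abs_of_pos (zero_lt_one.trans_le hg)]
    exact (div_le_self (abs_nonneg _) hg).trans (hlipw u v M hu hv s)
  have hQle : ∀ u, ‖u‖ ≤ M → ‖Q u‖ ≤ L * M ^ 3 := by
    intro u hu
    rw [← dist_zero_right]
    refine dist_le_of_abs_weighted_sub_le (r := r) fun s => ?_
    have hg := one_le_gam hrstar s
    have h0 : weighted r (0 : BoundedContinuousFunction (Rd d) ℝ) s = 0 := by simp [weighted]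
    rw [hQ, h0, sub_zero, abs_div, abs_of_pos (zero_lt_one.trans_le hg)]
    refine (div_le_self (abs_nonneg _) hg).trans ((hKw u M hu s).trans_eq (by ring))
  have hball : ∀ u ∈ Metric.closedBall u₀ 1, ‖u‖ ≤ M := by
    intro u hu
    rw [mem_closedBall_iff_norm] at hu
    have := norm_add_le u₀ (u - u₀)
    rw [add_sub_cancel] at this
    simp only [M]
    linarith
  have hLM : 0 < L * M ^ 3 := by positivity
  refine ⟨1 / (L * M ^ 3), by positivity, 1, one_pos, L * M ^ 3, hLM, ?_⟩
  rintro ε ⟨hε0, hε⟩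
  have hε1 : ε * (L * M ^ 3) ≤ 1 := (le_div_iff₀ hLM).1 hε
  have hε2 : ε / 2 * (L * M ^ 2) ≤ 1 / 2 := by
    have : M ^ 2 ≤ M ^ 3 := pow_le_pow_right₀ hM1 (by norm_num)
    have : ε * (L * M ^ 2) ≤ ε * (L * M ^ 3) := by gcongr
    linarith
  set Φ : BoundedContinuousFunction (Rd d) ℝ → BoundedContinuousFunction (Rd d) ℝ :=
    fun u => u₀ + (ε / 2) • Q u
  have hΦw : ∀ u s, weighted r (Φ u) s = b s ^ 2 / gam d rstar s
      + ε / 2 * (Kwk d (weighted r u) s / gam d rstar s) := by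
    intro u s
    have h1 := congrFun hu₀ s
    have h2 := congrFun (hQ u) s
    rw [← h1, ← h2]
    simp only [weighted, Φ, BoundedContinuousFunction.coe_add, BoundedContinuousFunction.coe_smul,
      Pi.add_apply, smul_eq_mul]
    ring
  have hΦdist : ∀ u, ‖u‖ ≤ M → dist (Φ u) u₀ ≤ L * M ^ 3 * ε := by
    intro u hu
    have := hQle u hu
    simp only [Φ, dist_eq_norm, add_sub_cancel_left, norm_smul, Real.norm_eq_abs]
    rw [abs_of_nonneg (by positivity)]
    calc ε / 2 * ‖Q u‖ ≤ ε / 2 * (L * M ^ 3) := by gcongr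
      _ ≤ L * M ^ 3 * ε := by nlinarith [mul_nonneg hε0 hLM.le]
  have hΦlip : ∀ u ∈ Metric.closedBall u₀ 1, ∀ v ∈ Metric.closedBall u₀ 1,
      dist (Φ u) (Φ v) ≤ 1 / 2 * dist u v := by
    intro u hu v hv
    have := hQlip u v (hball u hu) (hball v hv)
    simp only [Φ, dist_add_left]
    have hsub : (ε / 2) • Q u - (ε / 2) • Q v = (ε / 2) • (Q u - Q v) := (smul_sub _ _ _).symm
    rw [dist_eq_norm, hsub, norm_smul, ← dist_eq_norm, Real.norm_of_nonneg (by positivity)]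
    calc ε / 2 * dist (Q u) (Q v) ≤ ε / 2 * (L * M ^ 2 * dist u v) := by gcongr
      _ = ε / 2 * (L * M ^ 2) * dist u v := by ring
      _ ≤ 1 / 2 * dist u v := by gcongr
  have hmaps : Set.MapsTo Φ (Metric.closedBall u₀ 1) (Metric.closedBall u₀ 1) := fun u hu =>
    Metric.mem_closedBall.2 ((hΦdist u (hball u hu)).trans (by linarith))
  have hcontr : ContractingWith (1 / 2) (hmaps.restrict Φ _ _) :=
    ⟨by rw [← NNReal.coe_lt_coe]; norm_num, LipschitzWith.of_dist_le_mul fun u v => by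
      rw [Subtype.dist_eq, Subtype.dist_eq]
      simpa using hΦlip u u.2 v v.2⟩
  obtain ⟨u, hu, hfix, -⟩ := hcontr.exists_fixedPoint' Metric.isClosed_closedBall.isComplete
    hmaps (Metric.mem_closedBall_self zero_le_one) (edist_ne_top u₀ (Φ u₀))
  have hsol : ∀ v : BoundedContinuousFunction (Rd d) ℝ,
      IsSteadyState d r rstar b ε (weighted r v) ↔ Φ v = v := by
    intro v
    simp only [IsSteadyState, memCr_weighted, true_and, steadyState_iff hrstar, ← hΦw]
    constructor
    · intro h
      ext s
      exact (mul_right_cancel₀ (decayWeight_pos (r := r) s).ne' (h s)).symm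
    · intro h s
      rw [h]
  have hdist : ∀ (v : BoundedContinuousFunction (Rd d) ℝ) (N : ℝ),
      wNorm d r (fun s => weighted r v s - b s ^ 2 / gam d rstar s) ≤ N ↔ dist v u₀ ≤ N := by
    intro v N
    rw [wNorm_le_iff ((memCr_weighted v).sub hm)]
    have h0 : ∀ s, b s ^ 2 / gam d rstar s = weighted r u₀ s := fun s => (congrFun hu₀ s).symm
    simp only [h0]
    refine ⟨dist_le_of_abs_weighted_sub_le, fun h s => (abs_weighted_sub_le v u₀ s).trans ?_⟩
    exact mul_le_mul_of_nonneg_right h (decayWeight_pos s).le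
  refine ⟨weighted r u, ⟨(hsol u).2 hfix, (hdist u 1).2 hu⟩, (hdist u _).2 ?_, ?_⟩
  · have := hΦdist u (hball u hu)
    rwa [hfix] at this
  · intro y' hy' hy'd s
    obtain ⟨v, rfl⟩ := hy'.1.exists_weighted_eq
    have hv : v ∈ Metric.closedBall u₀ 1 := (hdist v 1).1 hy'd
    have h1 := hΦlip v hv u hu
    rw [(hsol v).1 hy', hfix] at h1
    have h2 : dist v u = 0 := le_antisymm (by linarith) dist_nonneg
    rw [dist_eq_zero.1 h2]
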